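/- There exists a constant C > 0, depending only on κ_1,…,κ_d, such that for every measurable function f on ℝ^d and every x ∈ ℝ^d_reg, 0 ≤ M_κ f(x) ≤ C M_κ^R f(x). -/

import Mathlib

noncomputable section
open MeasureTheory Set Real
open scoped ENNReal NNReal

/-- one-dimensional measure `dμ_κ(x) = |x|^{2κ} dx` -/
def muK1 (κ : ℝ) : Measure ℝ :=
  volume.withDensity fun x => ENNReal.ofReal (|x| ^ (2 * κ))

/-- the measure `μ_κ` on `ℝ^d` with density `∏_j |x_j|^{2κ_j}` -/
def muK (d : ℕ) (κ : Fin d → ℝ) : Measure (Fin d → ℝ) :=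
  volume.withDensity fun x => ENNReal.ofReal (∏ j, |x j| ^ (2 * κ j))

/-- the constant `M_κ = Γ(κ+1/2)/(Γ(κ)Γ(1/2))` -/
def Mconst (κ : ℝ) : ℝ := Real.Gamma (κ + 1/2) / (Real.Gamma κ * Real.Gamma (1/2))

/-- `σ_{x,y,z}` -/
def sigma3 (x y z : ℝ) : ℝ := if x ≠ 0 ∧ y ≠ 0 then (x^2 + y^2 - z^2) / (2*x*y) else 0

/-- area of the (possibly degenerate) triangle with side lengths `x,y,z` (Heron) -/
def triArea (x y z : ℝ) : ℝ :=
  Real.sqrt (((x+y+z)/2) * ((x+y+z)/2 - x) * ((x+y+z)/2 - y) * ((x+y+z)/2 - z))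

/-- the kernel `K_κ(x,y,z)` -/
def Kker (κ x y z : ℝ) : ℝ :=
  if |x - y| ≤ z ∧ z ≤ x + y then
    (2:ℝ) ^ (2*κ - 2) * Mconst κ * triArea x y z ^ (2*κ - 2) * (x*y*z) ^ (1 - 2*κ)
  else 0

/-- density of the measure `ν^{κ,+}_{x,y}` with respect to Lebesgue measure -/
def nuDens (κ x y z : ℝ) : ℝ≥0∞ :=
  ENNReal.ofReal ((1/2) * Kker κ |x| |y| |z| * (1 - sigma3 x y z) * |z| ^ (2*κ))

/-- the measure `ν^{κ,+}_{x,y}` -/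
def nuPlus (κ x y : ℝ) : Measure ℝ := volume.withDensity (nuDens κ x y)

/-- the product measure `υ^κ_{x,y} = ν^{κ_1,+}_{x_1,y_1} ⊗ ⋯ ⊗ ν^{κ_d,+}_{x_d,y_d}` -/
def upsilon (d : ℕ) (κ x y : Fin d → ℝ) : Measure (Fin d → ℝ) :=
  volume.withDensity fun z => ∏ j, nuDens (κ j) (x j) (y j) (z j)

/-- the set `ℝ^d_reg` of regular points -/
def regSet (d : ℕ) : Set (Fin d → ℝ) := {x | ∀ j, x j ≠ 0}

/-- the Euclidean ball of radius `r` centered at the origin -/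
def eBall (d : ℕ) (r : ℝ) : Set (Fin d → ℝ) := {x | ∑ j, (x j)^2 < r^2}

/-- the open cube `Q_r` -/
def cubeQ (d : ℕ) (r : ℝ) : Set (Fin d → ℝ) := {x | ∀ j, |x j| < r}

/-- the constant `c_κ` with `c_κ⁻¹ = ∫ e^{-‖x‖²/2} dμ_κ` -/
def cKappa (d : ℕ) (κ : Fin d → ℝ) : ℝ :=
  (∫ x, Real.exp (-(∑ j, (x j)^2) / 2) ∂(muK d κ))⁻¹

open Classical in
/-- the `ℤ_2^d` Dunkl maximal operator (explicit form), vanishing off `ℝ^d_reg` -/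
def Mdunkl (d : ℕ) (κ : Fin d → ℝ) (f : (Fin d → ℝ) → ℝ) (x : Fin d → ℝ) : ℝ≥0∞ :=
  if x ∈ regSet d then
    ⨆ (r : ℝ) (_ : 0 < r), ENNReal.ofReal
      ((cKappa d κ / (muK d κ (eBall d r)).toReal) *
        |∫ y in regSet d, f y * (upsilon d κ x (-y) (eBall d r)).toReal ∂(muK d κ)|)
  else 0

/-- the cube Dunkl maximal operator `M_κ^Q` (explicit form) -/
def MdunklQ (d : ℕ) (κ : Fin d → ℝ) (f : (Fin d → ℝ) → ℝ) (x : Fin d → ℝ) : ℝ≥0∞ :=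
  ⨆ (r : ℝ) (_ : 0 < r), ENNReal.ofReal
    ((cKappa d κ / (muK d κ (cubeQ d r)).toReal) *
      |∫ y in regSet d, f y * (upsilon d κ x (-y) (cubeQ d r)).toReal ∂(muK d κ)|)

/-- the interval `I(x,r) = [max{0,|x|-r}, |x|+r)` -/
def Iset (x r : ℝ) : Set ℝ := Set.Ico (max 0 (|x| - r)) (|x| + r)

/-- the rectangle `R(z,r) = I(z_1,r) × ⋯ × I(z_d,r)` -/
def Rset (d : ℕ) (z : Fin d → ℝ) (r : ℝ) : Set (Fin d → ℝ) :=
  Set.univ.pi fun j => Iset (z j) r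

/-- the weighted maximal operator `M_κ^R` -/
def MR (d : ℕ) (κ : Fin d → ℝ) (f : (Fin d → ℝ) → ℝ) (x : Fin d → ℝ) : ℝ≥0∞ :=
  ⨆ (r : ℝ) (_ : 0 < r),
    (muK d κ (Rset d x r))⁻¹ *
      ∫⁻ y in {y | (fun j => |y j|) ∈ Rset d x r}, ENNReal.ofReal |f y| ∂(muK d κ)

/-- Rösler's explicit formula for the one-dimensional Dunkl translation `τ_x^κ f(y)` -/
def tauK (κ x : ℝ) (f : ℝ → ℝ) (y : ℝ) : ℝ :=
  (1/2) * (∫ t in Set.Ioo (-1:ℝ) 1,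
      f (Real.sqrt (x^2 + y^2 + 2*x*y*t)) *
        (1 + (x + y) / Real.sqrt (x^2 + y^2 + 2*x*y*t)) *
        (Mconst κ * (1 + t) * (1 - t^2) ^ (κ - 1)))
  + (1/2) * (∫ t in Set.Ioo (-1:ℝ) 1,
      f (-Real.sqrt (x^2 + y^2 + 2*x*y*t)) *
        (1 - (x + y) / Real.sqrt (x^2 + y^2 + 2*x*y*t)) *
        (Mconst κ * (1 + t) * (1 - t^2) ^ (κ - 1)))

/-- an `ℝ≥0∞`-valued `L^p` norm for `ℝ≥0∞`-valued functions -/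
def lpNormE {α : Type*} [MeasurableSpace α] (g : α → ℝ≥0∞) (p : ℝ≥0∞) (μ : Measure α) : ℝ≥0∞ :=
  if p = ∞ then essSup g μ else (∫⁻ x, g x ^ p.toReal ∂μ) ^ (1 / p.toReal)

/-- the Hardy–Littlewood maximal operator over cubes centered at `x` -/
def HLmax (d : ℕ) (f : (Fin d → ℝ) → ℝ) (x : Fin d → ℝ) : ℝ≥0∞ :=
  ⨆ (r : ℝ) (_ : 0 < r),
    (volume {y : Fin d → ℝ | ∀ j, |y j - x j| < r})⁻¹ *
      ∫⁻ y in {y : Fin d → ℝ | ∀ j, |y j - x j| < r}, ENNReal.ofReal |f y| ∂volume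

theorem lintegral_one_sub_rpow {κ u : ℝ} (hκ : 0 < κ) (hu : 0 ≤ u) :
    ∫⁻ s in Icc (1 - u) 1, ENNReal.ofReal ((1 - s) ^ (κ - 1)) = ENNReal.ofReal (u ^ κ / κ) := by
  have hint : IntervalIntegrable (fun s : ℝ => (1 - s) ^ (κ - 1)) volume (1 - u) 1 := by
    have h : IntervalIntegrable (fun s : ℝ => s ^ (κ - 1)) volume u 0 :=
      intervalIntegral.intervalIntegrable_rpow' (by linarith)
    simpa using h.comp_sub_left 1
  rw [← restrict_Ioc_eq_restrict_Icc, ← ofReal_integral_eq_lintegral_ofReal,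
    ← intervalIntegral.integral_of_le (by linarith)]
  · rw [intervalIntegral.integral_comp_sub_left (fun s : ℝ => s ^ (κ - 1)) 1,
      integral_rpow (Or.inl (by linarith))]
    simp [Real.zero_rpow hκ.ne']
  · exact (intervalIntegrable_iff_integrableOn_Ioc_of_le (by linarith)).1 hint
  · filter_upwards [ae_restrict_mem measurableSet_Ioc] with s hs
    exact Real.rpow_nonneg (by linarith [hs.2]) _

theorem one_sub_sq_rpow_le {κ s : ℝ} (h0 : 0 ≤ s) (h1 : s ≤ 1) :
    (1 - s ^ 2) ^ (κ - 1) ≤ 2 ^ |κ - 1| * (1 - s) ^ (κ - 1) := by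
  have e : 1 - s ^ 2 = (1 + s) * (1 - s) := by ring
  rw [e, Real.mul_rpow (by linarith) (by linarith)]
  refine mul_le_mul_of_nonneg_right ?_ (Real.rpow_nonneg (by linarith) _)
  calc (1 + s) ^ (κ - 1) ≤ (1 + s) ^ |κ - 1| :=
        Real.rpow_le_rpow_of_exponent_le (by linarith) (le_abs_self _)
    _ ≤ 2 ^ |κ - 1| := by gcongr; linarith

theorem lintegral_one_sub_sq_rpow_le {κ u : ℝ} (hκ : 0 < κ) (hu : 0 ≤ u) (hu1 : u ≤ 1) :
    ∫⁻ s in Icc (1 - u) 1, ENNReal.ofReal ((1 - s ^ 2) ^ (κ - 1)) ≤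
      ENNReal.ofReal (2 ^ |κ - 1| / κ * u ^ κ) := by
  calc _ ≤ ∫⁻ s in Icc (1 - u) 1,
        ENNReal.ofReal (2 ^ |κ - 1|) * ENNReal.ofReal ((1 - s) ^ (κ - 1)) := by
        refine setLIntegral_mono' measurableSet_Icc fun s hs => ?_
        rw [← ENNReal.ofReal_mul (by positivity)]
        exact ENNReal.ofReal_le_ofReal (one_sub_sq_rpow_le (by linarith [hs.1]) hs.2)
    _ = _ := by
        rw [lintegral_const_mul' _ _ ENNReal.ofReal_ne_top, lintegral_one_sub_rpow hκ hu,
          ← ENNReal.ofReal_mul (by positivity)]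
        congr 1
        ring

theorem lintegral_one_sub_sq_rpow_neg (κ : ℝ) :
    ∫⁻ s in Icc (-1) 0, ENNReal.ofReal ((1 - s ^ 2) ^ (κ - 1)) =
      ∫⁻ s in Icc 0 1, ENNReal.ofReal ((1 - s ^ 2) ^ (κ - 1)) := by
  have h := (Measure.measurePreserving_neg (volume : Measure ℝ)).setLIntegral_comp_preimage_emb
    (MeasurableEquiv.neg ℝ).measurableEmbedding
    (fun s => ENNReal.ofReal ((1 - s ^ 2) ^ (κ - 1))) (Icc 0 1)
  rw [← h]
  simp

theorem lintegral_Icc_inter_one_sub_sq_rpow_le {κ u : ℝ} (hκ : 0 < κ) (hu : 0 ≤ u) :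
    ∫⁻ s in Icc (-1) 1 ∩ Ici (1 - u), ENNReal.ofReal ((1 - s ^ 2) ^ (κ - 1)) ≤
      ENNReal.ofReal (2 * (2 ^ |κ - 1| / κ) * min 1 u ^ κ) := by
  rcases le_total u 1 with h | h
  · calc _ ≤ ∫⁻ s in Icc (1 - u) 1, ENNReal.ofReal ((1 - s ^ 2) ^ (κ - 1)) :=
          lintegral_mono_set fun s hs => ⟨hs.2, hs.1.2⟩
      _ ≤ _ := lintegral_one_sub_sq_rpow_le hκ hu h
      _ ≤ _ := by
          rw [min_eq_right h]
          apply ENNReal.ofReal_le_ofReal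
          have : 0 ≤ 2 ^ |κ - 1| / κ * u ^ κ := by positivity
          linarith
  · have h1 := lintegral_one_sub_sq_rpow_le hκ zero_le_one le_rfl
    simp only [sub_self, Real.one_rpow, mul_one] at h1
    calc _ ≤ ∫⁻ s in Icc (-1) 0 ∪ Icc 0 1, ENNReal.ofReal ((1 - s ^ 2) ^ (κ - 1)) := by
          refine lintegral_mono_set fun s hs => ?_
          rcases le_total s 0 with h | h
          · exact Or.inl ⟨hs.1.1, h⟩
          · exact Or.inr ⟨h, hs.1.2⟩
      _ ≤ _ := lintegral_union_le _ _ _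
      _ ≤ ENNReal.ofReal (2 ^ |κ - 1| / κ) + ENNReal.ofReal (2 ^ |κ - 1| / κ) := by
          rw [lintegral_one_sub_sq_rpow_neg]
          exact add_le_add h1 h1
      _ = _ := by
          rw [← ENNReal.ofReal_add (by positivity) (by positivity), min_eq_left h]
          congr 1
          simp
          ring

theorem triArea_eq {a b z : ℝ} (ha : 0 < a) (hb : 0 < b) :
    triArea a b z = a * b / 2 * √(1 - ((a ^ 2 + b ^ 2 - z ^ 2) / (2 * a * b)) ^ 2) := by
  have h : 0 ≤ a * b / 2 := by positivity
  rw [triArea, ← Real.sqrt_sq h, ← Real.sqrt_mul (by positivity)]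
  congr 1
  field_simp
  ring

theorem cos_law_mem_Icc {a b z : ℝ} (ha : 0 < a) (hb : 0 < b) (h1 : |a - b| ≤ z)
    (h2 : z ≤ a + b) :
    (a ^ 2 + b ^ 2 - z ^ 2) / (2 * a * b) ∈ Icc (-1 : ℝ) 1 := by
  have hz : 0 ≤ z := (abs_nonneg _).trans h1
  have h3 : (a - b) ^ 2 ≤ z ^ 2 := by rw [← sq_abs (a - b)]; gcongr
  have h4 : z ^ 2 ≤ (a + b) ^ 2 := by gcongr
  constructor
  · rw [le_div_iff₀ (by positivity)]; nlinarith
  · rw [div_le_iff₀ (by positivity)]; nlinarith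

theorem Kker_mul_rpow {κ a b z : ℝ} (ha : 0 < a) (hb : 0 < b) (hz : 0 < z) (h1 : |a - b| ≤ z)
    (h2 : z ≤ a + b) :
    Kker κ a b z * z ^ (2 * κ) = Mconst κ *
      (z / (a * b) * (1 - ((a ^ 2 + b ^ 2 - z ^ 2) / (2 * a * b)) ^ 2) ^ (κ - 1)) := by
  rw [Kker, if_pos ⟨h1, h2⟩, triArea_eq ha hb]
  have hs := cos_law_mem_Icc ha hb h1 h2
  set s := (a ^ 2 + b ^ 2 - z ^ 2) / (2 * a * b)
  have hw : 0 ≤ 1 - s ^ 2 := by nlinarith [hs.1, hs.2]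
  have hab : 0 < a * b := by positivity
  have e1 : √(1 - s ^ 2) ^ (2 * κ - 2) = (1 - s ^ 2) ^ (κ - 1) := by
    rw [Real.sqrt_eq_rpow, ← Real.rpow_mul hw]
    congr 1
    ring
  have e2 : (a * b / 2) ^ (2 * κ - 2) = (a * b) ^ (2 * κ - 2) / 2 ^ (2 * κ - 2) :=
    Real.div_rpow hab.le zero_le_two _
  have e3 : (a * b) ^ (2 * κ - 2) * (a * b) ^ (1 - 2 * κ) = (a * b)⁻¹ := by
    rw [← Real.rpow_add hab, ← Real.rpow_neg_one]
    congr 1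
    ring
  have e4 : z ^ (1 - 2 * κ) * z ^ (2 * κ) = z := by
    rw [← Real.rpow_add hz]
    simp
  have e5 : (2 : ℝ) ^ (2 * κ - 2) ≠ 0 := by positivity
  rw [Real.mul_rpow (by positivity) (Real.sqrt_nonneg _), Real.mul_rpow hab.le hz.le, e1, e2]
  calc _ = Mconst κ * (1 - s ^ 2) ^ (κ - 1) * ((a * b) ^ (2 * κ - 2) * (a * b) ^ (1 - 2 * κ)) *
        (z ^ (1 - 2 * κ) * z ^ (2 * κ)) := by
        generalize (2 : ℝ) ^ (2 * κ - 2) = t at *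
        field_simp
    _ = _ := by
        rw [e3, e4]
        ring

theorem Mconst_pos {κ : ℝ} (hκ : 0 < κ) : 0 < Mconst κ := by
  have h1 := Real.Gamma_pos_of_pos hκ
  have h2 := Real.Gamma_pos_of_pos (show (0 : ℝ) < κ + 1 / 2 by linarith)
  have h3 := Real.Gamma_pos_of_pos (show (0 : ℝ) < 1 / 2 by norm_num)
  unfold Mconst
  positivity

theorem abs_sigma3 (x y z : ℝ) (hx : x ≠ 0) (hy : y ≠ 0) :
    |sigma3 x y z| = |(|x| ^ 2 + |y| ^ 2 - |z| ^ 2) / (2 * |x| * |y|)| := by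
  rw [sigma3, if_pos ⟨hx, hy⟩]
  simp [abs_div, abs_mul]

theorem Kker_nonneg {κ a b z : ℝ} (hκ : 0 < κ) (ha : 0 ≤ a) (hb : 0 ≤ b) (hz : 0 ≤ z) :
    0 ≤ Kker κ a b z := by
  have := Mconst_pos hκ
  have h : 0 ≤ triArea a b z := Real.sqrt_nonneg _
  unfold Kker
  split_ifs <;> positivity

theorem nuDens_le {κ x y z : ℝ} (hκ : 0 < κ) (hx : x ≠ 0) (hy : y ≠ 0) (hz : z ≠ 0)
    (h1 : |(|x| - |y|)| ≤ |z|) (h2 : |z| ≤ |x| + |y|) :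
    nuDens κ x y z ≤ ENNReal.ofReal (Mconst κ) * (ENNReal.ofReal |-z / (|x| * |y|)| *
      ENNReal.ofReal ((1 - ((|x| ^ 2 + |y| ^ 2 - z ^ 2) / (2 * |x| * |y|)) ^ 2) ^ (κ - 1))) := by
  have ha := abs_pos.2 hx
  have hb := abs_pos.2 hy
  have hc := abs_pos.2 hz
  have hK := Kker_mul_rpow (κ := κ) ha hb hc h1 h2
  have hs := abs_le.2 (cos_law_mem_Icc ha hb h1 h2)
  rw [← abs_sigma3 x y z hx hy] at hs
  rw [sq_abs z] at hK
  have hM := (Mconst_pos hκ).le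
  rw [← ENNReal.ofReal_mul (abs_nonneg _), ← ENNReal.ofReal_mul hM, abs_div, abs_neg, abs_mul,
    abs_abs, abs_abs, ← hK]
  apply ENNReal.ofReal_le_ofReal
  have hKn : 0 ≤ Kker κ |x| |y| |z| * |z| ^ (2 * κ) :=
    mul_nonneg (Kker_nonneg hκ ha.le hb.le hc.le) (by positivity)
  have := (abs_le.1 hs).1
  nlinarith

theorem nuDens_eq_zero {κ x y z : ℝ} (h : ¬(|(|x| - |y|)| ≤ |z| ∧ |z| ≤ |x| + |y|)) :
    nuDens κ x y z = 0 := by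
  simp [nuDens, Kker, h]

theorem lintegral_nuDens_le {κ x y r : ℝ} (hκ : 0 < κ) (hx : x ≠ 0) (hy : y ≠ 0)
    {S : Set ℝ} (hS : MeasurableSet S) (hr : ∀ z ∈ S, |z| < r ∧ z ≠ 0)
    (hinj : InjOn (fun z : ℝ => z ^ 2) S) :
    ∫⁻ z in S, nuDens κ x y z ≤ ENNReal.ofReal
      (Mconst κ * (2 * (2 ^ |κ - 1| / κ) * min 1 (r ^ 2 / (2 * |x| * |y|)) ^ κ)) := by
  have ha := abs_pos.2 hx
  have hb := abs_pos.2 hy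
  set q : ℝ → ℝ := fun z => (|x| ^ 2 + |y| ^ 2 - z ^ 2) / (2 * |x| * |y|) with hq
  set T := S ∩ {z | |(|x| - |y|)| ≤ |z| ∧ |z| ≤ |x| + |y|} with hT
  have hTm : MeasurableSet T := hS.inter (by measurability)
  have hd : ∀ z ∈ T, HasDerivWithinAt q (-z / (|x| * |y|)) T z := fun z _ => by
    have h := (((hasDerivAt_id z).pow 2).const_sub (|x| ^ 2 + |y| ^ 2)).div_const (2 * |x| * |y|)
    refine (h.congr_deriv ?_).hasDerivWithinAt
    simp
    field_simp
  have hqi : InjOn q T := fun z hz w hw h => hinj hz.1 hw.1 <| by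
    simp only [hq] at h
    rw [div_left_inj' (by positivity)] at h
    simpa using h
  calc _ ≤ ∫⁻ z in T, nuDens κ x y z := by
        rw [← lintegral_indicator hS, ← lintegral_indicator hTm]
        refine lintegral_mono fun z => ?_
        by_cases h : z ∈ S
        · by_cases h' : z ∈ T
          · simp [h, h']
          · rw [indicator_of_mem h, nuDens_eq_zero fun h2 => h' ⟨h, h2⟩]
            exact zero_le
        · simp [h]
    _ ≤ ∫⁻ z in T, ENNReal.ofReal (Mconst κ) * (ENNReal.ofReal |-z / (|x| * |y|)| *
          ENNReal.ofReal ((1 - (q z) ^ 2) ^ (κ - 1))) :=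
        setLIntegral_mono' hTm fun z hz => nuDens_le hκ hx hy (hr z hz.1).2 hz.2.1 hz.2.2
    _ = ENNReal.ofReal (Mconst κ) * ∫⁻ s in q '' T, ENNReal.ofReal ((1 - s ^ 2) ^ (κ - 1)) := by
        rw [lintegral_const_mul' _ _ ENNReal.ofReal_ne_top,
          lintegral_image_eq_lintegral_abs_deriv_mul hTm hd hqi]
    _ ≤ ENNReal.ofReal (Mconst κ) * ∫⁻ s in Icc (-1) 1 ∩ Ici (1 - r ^ 2 / (2 * |x| * |y|)),
          ENNReal.ofReal ((1 - s ^ 2) ^ (κ - 1)) := by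
        gcongr
        rintro _ ⟨z, hz, rfl⟩
        have hzr : z ^ 2 ≤ r ^ 2 := by
          rw [← sq_abs z]
          gcongr
          exact (hr z hz.1).1.le
        refine ⟨?_, ?_⟩
        · have := cos_law_mem_Icc ha hb hz.2.1 hz.2.2
          rwa [sq_abs z] at this
        · simp only [hq, mem_Ici]
          rw [sub_le_iff_le_add, ← add_div, le_div_iff₀ (by positivity)]
          nlinarith [sq_nonneg (|x| - |y|)]
    _ ≤ _ := by
        rw [ENNReal.ofReal_mul (Mconst_pos hκ).le]
        gcongr
        exact lintegral_Icc_inter_one_sub_sq_rpow_le hκ (by positivity)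

theorem lintegral_Ioo_nuDens_le {κ x y r : ℝ} (hκ : 0 < κ) (hx : x ≠ 0) (hy : y ≠ 0) :
    ∫⁻ z in Ioo (-r) r, nuDens κ x y z ≤ ENNReal.ofReal
      (2 * (Mconst κ * (2 * (2 ^ |κ - 1| / κ) * min 1 (r ^ 2 / (2 * |x| * |y|)) ^ κ))) := by
  have hM := Mconst_pos hκ
  have hP := lintegral_nuDens_le hκ hx hy (r := r) (S := Ioo 0 r) measurableSet_Ioo
    (fun z hz => ⟨by rw [abs_of_pos hz.1]; exact hz.2, hz.1.ne'⟩)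
    (fun z hz w hw h => (sq_eq_sq₀ hz.1.le hw.1.le).1 h)
  have hN := lintegral_nuDens_le hκ hx hy (r := r) (S := Ioo (-r) 0) measurableSet_Ioo
    (fun z hz => ⟨by rw [abs_of_neg hz.2]; linarith [hz.1], hz.2.ne⟩)
    (fun z hz w hw h => by
      rcases sq_eq_sq_iff_eq_or_eq_neg.1 h with h | h
      · exact h
      · linarith [hz.2, hw.2])
  calc _ ≤ ∫⁻ z in Ioo (-r) 0 ∪ ({0} ∪ Ioo 0 r), nuDens κ x y z := by
        refine lintegral_mono_set fun z hz => ?_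
        rcases lt_trichotomy z 0 with h | h | h
        · exact Or.inl ⟨hz.1, h⟩
        · exact Or.inr (Or.inl h)
        · exact Or.inr (Or.inr ⟨h, hz.2⟩)
    _ ≤ _ + (_ + _) := (lintegral_union_le _ _ _).trans
        (add_le_add_right (lintegral_union_le _ _ _) _)
    _ ≤ _ := by
        rw [two_mul, ENNReal.ofReal_add (by positivity) (by positivity)]
        simp only [Measure.restrict_singleton, Real.volume_singleton, zero_smul,
          lintegral_zero_measure, zero_add]
        exact add_le_add hN hP

theorem lintegral_Ioo_nuDens_le_rpow {κ x y r : ℝ} (hκ : 0 < κ) (hx : x ≠ 0) (hy : y ≠ 0)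
    (hr : 0 < r) (hxy : |(|x| - |y|)| < r) :
    ∫⁻ z in Ioo (-r) r, nuDens κ x y z ≤ ENNReal.ofReal
      (4 * Mconst κ * (2 ^ |κ - 1| / κ) * 9 ^ κ * (r ^ (2 * κ) / (|x| + r) ^ (2 * κ))) := by
  refine (lintegral_Ioo_nuDens_le hκ hx hy).trans (ENNReal.ofReal_le_ofReal ?_)
  have ha := abs_pos.2 hx
  have hb := abs_pos.2 hy
  have hM := Mconst_pos hκ
  have key : min 1 (r ^ 2 / (2 * |x| * |y|)) ≤ 9 * (r ^ 2 / (|x| + r) ^ 2) := by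
    rw [mul_div_assoc']
    rcases le_total |x| (2 * r) with h | h
    · refine (min_le_left _ _).trans ?_
      rw [one_le_div (by positivity)]
      nlinarith
    · refine (min_le_right _ _).trans ?_
      rw [div_le_div_iff₀ (by positivity) (by positivity)]
      have := (abs_lt.1 hxy).2
      nlinarith [mul_pos ha hb, sq_nonneg r,
        mul_nonneg (sq_nonneg r) (show 0 ≤ 9 * (2 * |x| * |y|) - (|x| + r) ^ 2 by nlinarith)]
  have e : (9 * (r ^ 2 / (|x| + r) ^ 2)) ^ κ = 9 ^ κ * (r ^ (2 * κ) / (|x| + r) ^ (2 * κ)) := by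
    rw [Real.mul_rpow (by positivity) (by positivity), Real.div_rpow (by positivity) (by positivity),
      Real.rpow_mul hr.le, Real.rpow_mul (by positivity)]
    simp
  have h := Real.rpow_le_rpow (by positivity) key hκ.le
  rw [e] at h
  calc _ = 4 * Mconst κ * (2 ^ |κ - 1| / κ) * min 1 (r ^ 2 / (2 * |x| * |y|)) ^ κ := by ring
    _ ≤ _ := by
      rw [mul_assoc (4 * Mconst κ * (2 ^ |κ - 1| / κ))]
      gcongr

theorem lintegral_Ioo_nuDens_eq_zero {κ x y r : ℝ} (hxy : r ≤ |(|x| - |y|)|) :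
    ∫⁻ z in Ioo (-r) r, nuDens κ x y z = 0 := by
  rw [setLIntegral_congr_fun measurableSet_Ioo (g := 0)]
  · simp
  · intro z hz
    exact nuDens_eq_zero fun h => by linarith [abs_lt.2 hz, h.1]

theorem measurable_nuDens (κ x y : ℝ) : Measurable (nuDens κ x y) := by
  unfold nuDens Kker triArea sigma3
  refine ENNReal.measurable_ofReal.comp (((Measurable.const_mul ?_ _).mul ?_).mul ?_)
  · refine Measurable.ite (by measurability) (by fun_prop) measurable_const
  · split_ifs <;> fun_prop
  · fun_prop

theorem lintegral_fin_prod_eq_prod {d : ℕ} {g : Fin d → ℝ → ℝ≥0∞} (hg : ∀ j, Measurable (g j)) :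
    ∫⁻ z : Fin d → ℝ, ∏ j, g j (z j) = ∏ j, ∫⁻ t, g j t := by
  induction d with
  | zero => simp [volume_pi]
  | succ n ih =>
    have h := (volume_preserving_piFinSuccAbove (fun _ : Fin (n + 1) => ℝ) 0).symm
    have hm : Measurable fun z : Fin n → ℝ => ∏ j : Fin n, g j.succ (z j) :=
      Finset.measurable_prod _ fun j _ => (hg j.succ).comp (measurable_pi_apply j)
    rw [← h.lintegral_comp (by fun_prop), Fin.prod_univ_succ, ← ih fun j => hg j.succ,
      Measure.volume_eq_prod, ← lintegral_prod_mul (hg 0).aemeasurable hm.aemeasurable]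
    simp [Fin.prod_univ_succ, MeasurableEquiv.piFinSuccAbove]

theorem measurableSet_eBall (d : ℕ) (r : ℝ) : MeasurableSet (eBall d r) :=
  measurableSet_lt (by fun_prop) measurable_const

theorem eBall_subset_cubeQ {d : ℕ} {r : ℝ} (hr : 0 < r) : eBall d r ⊆ cubeQ d r := fun z hz j => by
  refine abs_lt_of_sq_lt_sq ?_ hr.le
  exact (Finset.single_le_sum (f := fun j => z j ^ 2) (fun i _ => sq_nonneg _)
    (Finset.mem_univ j)).trans_lt hz

theorem upsilon_eBall_le {d : ℕ} (κ x y : Fin d → ℝ) {r : ℝ} (hr : 0 < r) :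
    upsilon d κ x y (eBall d r) ≤ ∏ j, ∫⁻ z in Ioo (-r) r, nuDens (κ j) (x j) (y j) z := by
  rw [upsilon, withDensity_apply', ← lintegral_indicator (measurableSet_eBall d r)]
  simp_rw [← lintegral_indicator (measurableSet_Ioo (a := -r) (b := r))]
  rw [← lintegral_fin_prod_eq_prod fun j => (measurable_nuDens _ _ _).indicator measurableSet_Ioo]
  refine lintegral_mono fun z => ?_
  by_cases hz : z ∈ eBall d r
  · have h : ∀ j, z j ∈ Ioo (-r) r := fun j => abs_lt.1 (eBall_subset_cubeQ hr hz j)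
    simp [hz, h]
  · simp [hz]

theorem le_muK_eBall {d : ℕ} (hd : 1 ≤ d) (κ : Fin d → ℝ) (hκ : ∀ j, 0 < κ j) {r : ℝ}
    (hr : 0 < r) :
    ENNReal.ofReal (∏ j, (r / (2 * d)) * (r / (2 * d)) ^ (2 * κ j)) ≤ muK d κ (eBall d r) := by
  have hd' : (1 : ℝ) ≤ d := by exact_mod_cast hd
  set s := r / (2 * d) with hs
  have hs0 : 0 < s := by positivity
  have hsub : univ.pi (fun _ : Fin d => Ioo s (2 * s)) ⊆ eBall d r := fun z hz => by
    have h : ∀ j ∈ Finset.univ, z j ^ 2 < (2 * s) ^ 2 := fun j _ => by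
      have := hz j trivial
      exact pow_lt_pow_left₀ this.2 (hs0.trans this.1).le two_ne_zero
    have hne : (Finset.univ : Finset (Fin d)).Nonempty := ⟨⟨0, hd⟩, Finset.mem_univ _⟩
    have h2 := Finset.sum_lt_sum_of_nonempty hne h
    rw [Finset.sum_const, Finset.card_univ, Fintype.card_fin, nsmul_eq_mul] at h2
    refine h2.trans_le ?_
    have e : 2 * s * d = r := by rw [hs]; field_simp
    rw [← e]
    nlinarith [sq_nonneg (2 * s)]
  have hm : MeasurableSet (univ.pi fun _ : Fin d => Ioo s (2 * s)) :=
    MeasurableSet.univ_pi fun _ => measurableSet_Ioo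
  calc _ = ∫⁻ z in univ.pi fun _ : Fin d => Ioo s (2 * s),
          ENNReal.ofReal (∏ j, s ^ (2 * κ j)) := by
        rw [setLIntegral_const, volume_pi_pi, Finset.prod_mul_distrib,
          ENNReal.ofReal_mul (by positivity), mul_comm,
          ENNReal.ofReal_prod_of_nonneg (f := fun _ => s) fun _ _ => hs0.le]
        simp only [Real.volume_Ioo]
        ring_nf
    _ ≤ ∫⁻ z in univ.pi fun _ : Fin d => Ioo s (2 * s),
          ENNReal.ofReal (∏ j, |z j| ^ (2 * κ j)) := by
        refine setLIntegral_mono' hm fun z hz => ENNReal.ofReal_le_ofReal ?_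
        refine Finset.prod_le_prod (fun j _ => by positivity) fun j _ => ?_
        exact Real.rpow_le_rpow hs0.le ((hz j trivial).1.le.trans (le_abs_self _))
          (by linarith [hκ j])
    _ ≤ _ := by
        rw [muK, withDensity_apply']
        exact lintegral_mono_set hsub

theorem measurableSet_Rset (d : ℕ) (x : Fin d → ℝ) (r : ℝ) : MeasurableSet (Rset d x r) :=
  MeasurableSet.univ_pi fun _ => measurableSet_Ico

theorem muK_Rset_le {d : ℕ} (κ : Fin d → ℝ) (hκ : ∀ j, 0 < κ j) (x : Fin d → ℝ) {r : ℝ}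
    (hr : 0 < r) :
    muK d κ (Rset d x r) ≤ ENNReal.ofReal (∏ j, (2 * r) * (|x j| + r) ^ (2 * κ j)) := by
  calc _ = ∫⁻ z in Rset d x r, ENNReal.ofReal (∏ j, |z j| ^ (2 * κ j)) := by
        rw [muK, withDensity_apply']
    _ ≤ ∫⁻ z in Rset d x r, ENNReal.ofReal (∏ j, (|x j| + r) ^ (2 * κ j)) := by
        refine setLIntegral_mono' (measurableSet_Rset d x r) fun z hz =>
          ENNReal.ofReal_le_ofReal ?_
        refine Finset.prod_le_prod (fun j _ => by positivity) fun j _ => ?_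
        have h := hz j trivial
        rw [abs_of_nonneg ((le_max_left _ _).trans h.1)]
        exact Real.rpow_le_rpow ((le_max_left _ _).trans h.1) h.2.le (by linarith [hκ j])
    _ ≤ _ := by
        rw [setLIntegral_const, Rset, volume_pi_pi, Finset.prod_mul_distrib, mul_comm,
          ENNReal.ofReal_mul (by positivity),
          ENNReal.ofReal_prod_of_nonneg (f := fun _ => 2 * r) fun _ _ => by positivity]
        gcongr with j
        rw [Iset, Real.volume_Ico]
        apply ENNReal.ofReal_le_ofReal
        linarith [le_max_right 0 (|x j| - r)]

/-- The constant of the one-dimensional translation estimate. -/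
def nuBound (κ : ℝ) : ℝ := 4 * Mconst κ * (2 ^ |κ - 1| / κ) * 9 ^ κ

theorem nuBound_pos {κ : ℝ} (hκ : 0 < κ) : 0 < nuBound κ := by
  have := Mconst_pos hκ
  unfold nuBound
  positivity

theorem upsilon_eBall_le_rpow {d : ℕ} {κ : Fin d → ℝ} (hκ : ∀ j, 0 < κ j) {x y : Fin d → ℝ}
    (hx : x ∈ regSet d) (hy : y ∈ regSet d) {r : ℝ} (hr : 0 < r) :
    upsilon d κ x y (eBall d r) ≤ {y | (fun j => |y j|) ∈ Rset d x r}.indicator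
      (fun _ => ENNReal.ofReal
        (∏ j, nuBound (κ j) * (r ^ (2 * κ j) / (|x j| + r) ^ (2 * κ j)))) y := by
  refine (upsilon_eBall_le κ x y hr).trans ?_
  by_cases h : ∀ j, |(|x j| - |y j|)| < r
  · have hmem : y ∈ {y : Fin d → ℝ | (fun j => |y j|) ∈ Rset d x r} := fun j _ => by
      have := abs_lt.1 (h j)
      exact ⟨max_le (abs_nonneg _) (by linarith), by linarith⟩
    rw [indicator_of_mem hmem, ENNReal.ofReal_prod_of_nonneg fun j _ => by
      have := nuBound_pos (hκ j)
      positivity]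
    gcongr with j
    exact lintegral_Ioo_nuDens_le_rpow (hκ j) (hx j) (hy j) hr (h j)
  · push Not at h
    obtain ⟨j, hj⟩ := h
    rw [Finset.prod_eq_zero (Finset.mem_univ j) (lintegral_Ioo_nuDens_eq_zero hj)]
    exact zero_le

theorem measurableSet_regSet (d : ℕ) : MeasurableSet (regSet d) := by
  have : regSet d = ⋂ j, {x | x j ≠ 0} := by ext; simp [regSet]
  rw [this]
  exact MeasurableSet.iInter fun j =>
    measurableSet_eq_fun (measurable_pi_apply j) measurable_const |>.compl

theorem ofReal_abs_integral_upsilon_le {d : ℕ} {κ : Fin d → ℝ} (hκ : ∀ j, 0 < κ j)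
    (f : (Fin d → ℝ) → ℝ) {x : Fin d → ℝ} (hx : x ∈ regSet d) {r : ℝ} (hr : 0 < r) :
    ENNReal.ofReal |∫ y in regSet d, f y * (upsilon d κ x (-y) (eBall d r)).toReal ∂(muK d κ)| ≤
      ENNReal.ofReal (∏ j, nuBound (κ j) * (r ^ (2 * κ j) / (|x j| + r) ^ (2 * κ j))) *
        ∫⁻ y in {y | (fun j => |y j|) ∈ Rset d x r}, ENNReal.ofReal |f y| ∂(muK d κ) := by
  set A := {y : Fin d → ℝ | (fun j => |y j|) ∈ Rset d x r} with hA
  have hAm : MeasurableSet A := measurableSet_Rset d x r |>.preimage (by fun_prop)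
  set B := ENNReal.ofReal (∏ j, nuBound (κ j) * (r ^ (2 * κ j) / (|x j| + r) ^ (2 * κ j)))
  rw [← Real.norm_eq_abs, ofReal_norm]
  calc _ ≤ ∫⁻ y in regSet d, ‖f y * (upsilon d κ x (-y) (eBall d r)).toReal‖ₑ ∂(muK d κ) :=
        enorm_integral_le_lintegral_enorm _
    _ ≤ ∫⁻ y in regSet d, A.indicator (fun y => B * ENNReal.ofReal |f y|) y ∂(muK d κ) := by
        refine setLIntegral_mono' (measurableSet_regSet d) fun y hy => ?_
        have hy' : -y ∈ regSet d := fun j => neg_ne_zero.2 (hy j)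
        have h := upsilon_eBall_le_rpow hκ hx hy' hr
        have hAy : -y ∈ A ↔ y ∈ A := by simp [hA]
        rw [enorm_mul, Real.enorm_eq_ofReal_abs, Real.enorm_of_nonneg ENNReal.toReal_nonneg,
          mul_comm]
        refine (mul_le_mul_left (ENNReal.ofReal_toReal_le.trans h) _).trans ?_
        by_cases hyA : y ∈ A
        · rw [indicator_of_mem (hAy.2 hyA), indicator_of_mem hyA]
        · rw [indicator_of_notMem (mt hAy.1 hyA), zero_mul]
          exact zero_le
    _ ≤ ∫⁻ y, A.indicator (fun y => B * ENNReal.ofReal |f y|) y ∂(muK d κ) :=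
        setLIntegral_le_lintegral _ _
    _ = _ := by
        rw [lintegral_indicator hAm, lintegral_const_mul' _ _ ENNReal.ofReal_ne_top]

theorem cKappa_nonneg (d : ℕ) (κ : Fin d → ℝ) : 0 ≤ cKappa d κ :=
  inv_nonneg.2 (integral_nonneg fun _ => (Real.exp_pos _).le)

theorem ofReal_div_toReal_le {c p : ℝ} (hc : 0 ≤ c) (hp : 0 < p) {m : ℝ≥0∞}
    (h : ENNReal.ofReal p ≤ m) : ENNReal.ofReal (c / m.toReal) ≤ ENNReal.ofReal (c / p) := by
  apply ENNReal.ofReal_le_ofReal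
  by_cases hm : m = ∞
  · simp only [hm, ENNReal.toReal_top, div_zero]
    positivity
  · gcongr
    exact (ENNReal.ofReal_le_iff_le_toReal hm).1 h

/-- The weighted maximal operator `M_κ^R` controls the `ℤ_2^d` Dunkl maximal operator `M_κ`
on regular points. -/
theorem Mdunkl_le_MR
    (d : ℕ) (hd : 1 ≤ d) (κ : Fin d → ℝ) (hκ : ∀ j, 0 < κ j) :
    ∃ C : ℝ, 0 < C ∧ ∀ f : (Fin d → ℝ) → ℝ, Measurable f →
      ∀ x ∈ regSet d, 0 ≤ Mdunkl d κ f x ∧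
        Mdunkl d κ f x ≤ ENNReal.ofReal C * MR d κ f x := by
  have hc := cKappa_nonneg d κ
  have hd' : (0 : ℝ) < d := by exact_mod_cast hd
  have hD : 0 < ∏ j, nuBound (κ j) * (2 * (2 * d) * (2 * (d : ℝ)) ^ (2 * κ j)) :=
    Finset.prod_pos fun j _ => by
      have := nuBound_pos (hκ j)
      positivity
  set D := ∏ j, nuBound (κ j) * (2 * (2 * d) * (2 * (d : ℝ)) ^ (2 * κ j)) with hDdef
  refine ⟨(cKappa d κ + 1) * D, by positivity, fun f _ x hx => ⟨zero_le, ?_⟩⟩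
  rw [Mdunkl, if_pos hx]
  refine iSup₂_le fun r hr => ?_
  rw [MR]
  refine le_trans ?_ (mul_le_mul_right (le_iSup₂ (f := fun (r : ℝ) (_ : 0 < r) =>
    (muK d κ (Rset d x r))⁻¹ *
      ∫⁻ y in {y | (fun j => |y j|) ∈ Rset d x r}, ENNReal.ofReal |f y| ∂(muK d κ)) r hr) _)
  set I := ∫⁻ y in {y | (fun j => |y j|) ∈ Rset d x r}, ENNReal.ofReal |f y| ∂(muK d κ)
  set p := ∏ j, (r / (2 * d)) * (r / (2 * d)) ^ (2 * κ j) with hp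
  set q := ∏ j, (2 * r) * (|x j| + r) ^ (2 * κ j) with hq
  set B := ∏ j, nuBound (κ j) * (r ^ (2 * κ j) / (|x j| + r) ^ (2 * κ j)) with hB
  have hp0 : 0 < p := Finset.prod_pos fun j _ => by positivity
  have hq0 : 0 < q := Finset.prod_pos fun j _ => by positivity
  have key : B / p = D / q := by
    rw [hB, hp, hq, hDdef, ← Finset.prod_div_distrib, ← Finset.prod_div_distrib]
    refine Finset.prod_congr rfl fun j _ => ?_
    rw [Real.div_rpow hr.le (by positivity)]
    have h1 : r ^ (2 * κ j) ≠ 0 := by positivity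
    have h2 : (|x j| + r) ^ (2 * κ j) ≠ 0 := by positivity
    have h3 : (2 * (d : ℝ)) ^ (2 * κ j) ≠ 0 := by positivity
    generalize r ^ (2 * κ j) = a at *
    generalize (|x j| + r) ^ (2 * κ j) = b at *
    generalize (2 * (d : ℝ)) ^ (2 * κ j) = e at *
    field_simp
  rw [ENNReal.ofReal_mul (by positivity)]
  calc _ ≤ ENNReal.ofReal (cKappa d κ / p) * (ENNReal.ofReal B * I) :=
        mul_le_mul' (ofReal_div_toReal_le hc hp0 (le_muK_eBall hd κ hκ hr))
          (ofReal_abs_integral_upsilon_le hκ f hx hr)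
    _ = ENNReal.ofReal (cKappa d κ * D) * ((ENNReal.ofReal q)⁻¹ * I) := by
        rw [← mul_assoc, ← mul_assoc, ← ENNReal.ofReal_inv_of_pos hq0,
          ← ENNReal.ofReal_mul (by positivity), ← ENNReal.ofReal_mul (by positivity)]
        congr 2
        rw [div_mul_eq_mul_div, mul_div_assoc, key]
        ring
    _ ≤ _ := by
        gcongr
        · linarith
        · exact muK_Rset_le κ hκ x hr
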